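/- Let q be a prime power, n ≥ 1, and let A be an n×n matrix over F_{q²}. Then the following are equivalent: (i) there exists an invertible n×n matrix P over F_{q²} such that P A P⁻¹ is Hermitian, i.e. (P A P⁻¹)* = P A P⁻¹; (ii) there exists an invertible n×n matrix P over F_{q²} such that every entry of P A P⁻¹ lies in the subfield F_q of F_{q²} (equivalently, is fixed by x ↦ x^q). -/

import Mathlib

open Matrix

open Polynomial in
theorem hcr_struct {k : Type} [Field k] {n : ℕ} (A : Matrix (Fin n) (Fin n) k) :
    ∃ (ι : Type) (_ : Fintype ι) (p : ι → k[X]) (e : ι → ℕ),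
      (∀ i, Irreducible (p i)) ∧ (∀ i, (p i).Monic) ∧
      ∃ Φ : (Fin n → k) ≃ₗ[k] (∀ i, AdjoinRoot (p i ^ e i)),
        ∀ (f : k[X]) v i, Φ ((aeval A f) *ᵥ v) i = AdjoinRoot.mk _ f * Φ v i := by
  classical
  have hT : Module.IsTorsion k[X] (Module.AEval k (Fin n → k) (Matrix.toLin' A)) :=
    Module.AEval.isTorsion_of_finiteDimensional _ _ _
  obtain ⟨ι, hι, p, hp, e, ⟨Ψ⟩⟩ := Module.equiv_directSum_of_isTorsion hT
  refine ⟨ι, hι, fun i => normalize (p i), e, fun i => ?_, fun i => ?_, ?_⟩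
  · exact (normalize_associated (p i)).symm.irreducible (hp i)
  · exact Polynomial.monic_normalize (hp i).ne_zero
  have hspan : ∀ i, (k[X] ∙ p i ^ e i) = Ideal.span {normalize (p i) ^ e i} := fun i => by
    refine Ideal.span_singleton_eq_span_singleton.2 ?_
    exact ((normalize_associated (p i)).symm.pow_pow)
  let Θ : (DirectSum ι fun i => k[X] ⧸ (k[X] ∙ p i ^ e i)) ≃ₗ[k[X]]
      (∀ i, k[X] ⧸ (Ideal.span {normalize (p i) ^ e i})) :=
    (DirectSum.linearEquivFunOnFintype k[X] ι _).trans
      (LinearEquiv.piCongrRight fun i => Submodule.quotEquivOfEq _ _ (hspan i))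
  let Ω := Ψ.trans Θ
  let Φ0 : (Fin n → k) ≃+ (∀ i, AdjoinRoot (normalize (p i) ^ e i)) :=
    (Module.AEval.of k _ (Matrix.toLin' A)).toAddEquiv.trans Ω.toAddEquiv
  have key : ∀ (f : k[X]) v i, Φ0 ((aeval A f) *ᵥ v) i = AdjoinRoot.mk _ f * Φ0 v i := by
    intro f v i
    have h1 : (aeval A f) *ᵥ v = aeval (Matrix.toLin' A) f • v := by
      have : aeval (Matrix.toLin' A) f = Matrix.toLin' (aeval A f) := by
        exact Polynomial.aeval_algHom_apply (Matrix.toLinAlgEquiv' (R := k) (n := Fin n)).toAlgHom A f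
      rw [this]; rfl
    have h2 : Ω (Module.AEval.of k _ (Matrix.toLin' A) ((aeval A f) *ᵥ v)) =
        f • Ω (Module.AEval.of k _ (Matrix.toLin' A) v) := by
      rw [h1, Module.AEval.of_aeval_smul, map_smul]
    exact congrFun h2 i
  refine ⟨{ Φ0 with map_smul' := ?_ }, key⟩
  intro c v
  funext i
  have := key (C c) v i
  rw [aeval_C, Algebra.algebraMap_eq_smul_one, smul_mulVec, one_mulVec] at this
  refine this.trans ?_
  simp [Algebra.smul_def, Φ0]

open Polynomial in
theorem hcr_func {k : Type} [Field k] (g : k[X]) (hg : g.Monic) :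
    ∃ l : AdjoinRoot g →ₗ[k] k, ∀ x, (∀ y, l (y * x) = 0) → x = 0 := by
  refine ⟨(lcoeff k (g.natDegree - 1)).comp (AdjoinRoot.modByMonicHom hg), fun x hx => ?_⟩
  obtain ⟨r, rfl⟩ := AdjoinRoot.mk_surjective x
  by_contra h0
  set s := r %ₘ g with hs
  have hrs : AdjoinRoot.mk g r = AdjoinRoot.mk g s := by
    rw [AdjoinRoot.mk_eq_mk, hs, Polynomial.modByMonic_eq_sub_mul_div]; simp
  rw [hrs] at h0 hx
  have hs0 : s ≠ 0 := fun h => h0 (by rw [h, map_zero])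
  have hg1 : g ≠ 1 := fun h => h0 (by rw [AdjoinRoot.mk_eq_zero, h]; exact one_dvd _)
  have hlt : s.natDegree < g.natDegree := natDegree_modByMonic_lt r hg hg1
  have := hx (AdjoinRoot.mk g (X ^ (g.natDegree - 1 - s.natDegree)))
  rw [← map_mul] at this
  simp only [LinearMap.comp_apply, AdjoinRoot.modByMonicHom_mk, lcoeff_apply] at this
  rw [(modByMonic_eq_self_iff hg).2] at this
  · rw [show g.natDegree - 1 = s.natDegree + (g.natDegree - 1 - s.natDegree) by omega,
      show s.natDegree + (g.natDegree - 1 - s.natDegree) - s.natDegree =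
        g.natDegree - 1 - s.natDegree by omega, mul_comm, coeff_mul_X_pow] at this
    exact hs0 (leadingCoeff_eq_zero.1 this)
  · apply degree_lt_degree
    rw [natDegree_mul (pow_ne_zero _ X_ne_zero) hs0, natDegree_X_pow]
    omega

open Polynomial in
theorem hcr_symm {k : Type} [Field k] {n : ℕ} (A : Matrix (Fin n) (Fin n) k) :
    ∃ S : Matrix (Fin n) (Fin n) k, IsUnit S ∧ Sᵀ = S ∧ S * A = Aᵀ * S := by
  classical
  obtain ⟨ι, _, p, e, hp, hm, Φ, hΦ⟩ := hcr_struct A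
  choose l hl using fun i => hcr_func (p i ^ e i) ((hm i).pow _)
  have hX : ∀ v i, Φ (A *ᵥ v) i = AdjoinRoot.mk _ X * Φ v i := fun v i => by
    have := hΦ X v i
    rwa [aeval_X] at this
  let β : (Fin n → k) → (Fin n → k) → k := fun v w => ∑ i, l i (Φ v i * Φ w i)
  let S : Matrix (Fin n) (Fin n) k := Matrix.of fun a b => β (Pi.single a 1) (Pi.single b 1)
  have hSv : ∀ a v, (S *ᵥ v) a = β (Pi.single a 1) v := by
    intro a v
    have : v = ∑ b, v b • (Pi.single b 1 : Fin n → k) := by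
      ext j; simp [Finset.sum_apply, Pi.single_apply]
    conv_rhs => rw [this]
    simp only [β, map_sum, map_smul, Finset.sum_apply, Pi.smul_apply, Finset.mul_sum,
      mul_smul_comm]
    rw [Finset.sum_comm]
    simp only [Matrix.mulVec, dotProduct, S, of_apply, β, smul_eq_mul, Finset.sum_mul]
    simp only [mul_comm]
  have hsymm : Sᵀ = S := by
    ext a b
    simp [S, β, mul_comm]
  refine ⟨S, ?_, hsymm, ?_⟩
  · rw [← Matrix.mulVec_injective_iff_isUnit]
    rw [← Matrix.coe_mulVecLin, ← LinearMap.ker_eq_bot, LinearMap.ker_eq_bot']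
    intro v hv
    have hb : ∀ w, β w v = 0 := by
      intro w
      have : w = ∑ b, w b • (Pi.single b 1 : Fin n → k) := by
        ext j; simp [Finset.sum_apply, Pi.single_apply]
      rw [this]
      simp only [β, map_sum, map_smul, Finset.sum_apply, Pi.smul_apply, Finset.sum_mul,
        smul_mul_assoc]
      rw [Finset.sum_comm]
      refine Finset.sum_eq_zero fun b _ => ?_
      rw [← Finset.smul_sum]
      have := congrFun hv b
      rw [Matrix.mulVecLin_apply, hSv] at this
      simp only [β] at this
      rw [this]; simp
    apply Φ.injective
    rw [map_zero]
    funext i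
    refine hl i _ fun y => ?_
    have := hb (Φ.symm (Pi.single i y))
    simp only [β, LinearEquiv.apply_symm_apply] at this
    rw [Finset.sum_eq_single i] at this
    · simpa using this
    · intro j _ hj
      simp [Pi.single_eq_of_ne hj]
    · simp
  · have h1 : ∀ a b, (S * A) a b = β (Pi.single a 1) (A *ᵥ Pi.single b 1) := by
      intro a b
      rw [← hSv, Matrix.mulVec_mulVec]; simp
    have h2 : Aᵀ * S = (S * A)ᵀ := by rw [transpose_mul, hsymm]
    rw [h2]
    ext a b
    rw [transpose_apply, h1, h1]
    simp only [β, hX]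
    refine Finset.sum_congr rfl fun i _ => ?_
    congr 1; ring

theorem hcr_onb {K : Type} [Field K] (σ : K →+* K) (hσ : ∀ x, σ (σ x) = x)
    (α : K) (hα : σ α ≠ α) (hN : ∀ c, σ c = c → c ≠ 0 → ∃ y, σ y * y = c)
    {n : ℕ} (S : Matrix (Fin n) (Fin n) K) (hS : IsUnit S) (hH : (S.map σ)ᵀ = S) :
    ∃ V : Matrix (Fin n) (Fin n) K, (V.map σ)ᵀ * S * V = 1 := by
  classical
  let h : (Fin n → K) → (Fin n → K) → K := fun v w => (fun i => σ (v i)) ⬝ᵥ (S *ᵥ w)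
  have hadd : ∀ u v w, h u (v + w) = h u v + h u w := fun u v w => by
    simp [h, mulVec_add, dotProduct_add]
  have hsmul : ∀ u (c : K) w, h u (c • w) = c * h u w := fun u c w => by
    simp [h, mulVec_smul, dotProduct_smul]
  have hconj : ∀ v w, σ (h v w) = h w v := fun v w => by
    simp only [h, dotProduct, mulVec, map_sum, map_mul, hσ, Finset.mul_sum]
    rw [Finset.sum_comm]
    refine Finset.sum_congr rfl fun i _ => Finset.sum_congr rfl fun j _ => ?_
    have : σ (S j i) = S i j := by
      conv_rhs => rw [← hH]
      rfl
    rw [this]; ring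
  have hadd2 : ∀ u v w, h (u + v) w = h u w + h v w := fun u v w => by
    rw [← hconj, hadd, map_add, hconj, hconj]
  have hzero : ∀ v, h v 0 = 0 := fun v => by simp [h]
  let hl : (Fin n → K) → (Fin n → K) →ₗ[K] K := fun v =>
    { toFun := h v, map_add' := hadd v, map_smul' := fun c w => by simp [hsmul] }
  have hsum : ∀ {m : ℕ} v (f : Fin m → Fin n → K), h v (∑ i, f i) = ∑ i, h v (f i) :=
    fun v f => map_sum (hl v) f _
  have main : ∀ m : ℕ, m ≤ n → ∃ v : Fin m → Fin n → K, ∀ i j,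
      h (v i) (v j) = if i = j then 1 else 0 := by
    intro m
    induction m with
    | zero => exact fun _ => ⟨Fin.elim0, fun i => i.elim0⟩
    | succ m ih =>
      intro hm
      obtain ⟨v, hv⟩ := ih (by omega)
      let L : (Fin n → K) →ₗ[K] (Fin m → K) := LinearMap.pi fun i => hl (v i)
      have hker : LinearMap.ker L ≠ ⊥ := LinearMap.ker_ne_bot_of_finrank_lt (by simp; omega)
      have hW : ∀ w, w ∈ LinearMap.ker L ↔ ∀ i, h (v i) w = 0 := fun w => by
        rw [LinearMap.mem_ker, funext_iff]; rfl
      have hex : ∃ w, w ∈ LinearMap.ker L ∧ h w w ≠ 0 := by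
        by_contra hcon
        push Not at hcon
        obtain ⟨w, hw, hw0⟩ := Submodule.exists_mem_ne_zero_of_ne_bot hker
        have hc2 : ∀ w' ∈ LinearMap.ker L, h w w' = 0 := by
          intro w' hw'
          by_contra hz
          have key : ∀ d, d + σ d = 0 := by
            intro d
            have hcw : (d / h w w') • w' ∈ LinearMap.ker L := Submodule.smul_mem _ _ hw'
            have h1 := hcon _ (Submodule.add_mem _ hw hcw)
            have h2 := hcon _ hcw
            have h3 := hcon _ hw
            have h4 : h w ((d / h w w') • w') = d := by rw [hsmul, div_mul_cancel₀ _ hz]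
            have h5 : h ((d / h w w') • w') w = σ d := by rw [← hconj, h4]
            rw [hadd, hadd2, hadd2, h2, h3, h4, h5] at h1
            linear_combination h1
          have k1 := key 1
          have k2 := key α
          rw [map_one] at k1
          apply hα
          linear_combination k2 - α * k1
        apply hw0
        have hall : ∀ x, h w x = 0 := by
          intro x
          have hx : x - ∑ i, h (v i) x • v i ∈ LinearMap.ker L := by
            rw [hW]
            intro i
            have : h (v i) (x - ∑ i, h (v i) x • v i) = h (v i) x - h (v i) (∑ i, h (v i) x • v i) :=
              map_sub (hl (v i)) _ _
            rw [this, hsum]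
            simp [hsmul, hv]
          have h1 := hc2 _ hx
          have : h w (x - ∑ i, h (v i) x • v i) = h w x - h w (∑ i, h (v i) x • v i) :=
              map_sub (hl w) _ _
          rw [this, hsum] at h1
          rw [Finset.sum_eq_zero, sub_zero] at h1
          · exact h1
          · intro i _
            rw [hsmul, ← hconj (v i) w, (hW w).1 hw i, map_zero, mul_zero]
        funext a
        have h1 := hall (S⁻¹ *ᵥ Pi.single a 1)
        simp only [h] at h1
        rw [mulVec_mulVec, Matrix.mul_nonsing_inv _ ((Matrix.isUnit_iff_isUnit_det _).1 hS),
          one_mulVec] at h1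
        simpa using h1
      obtain ⟨w, hw, hww⟩ := hex
      obtain ⟨y, hy⟩ := hN (h w w) (hconj w w) hww
      have hy0 : y ≠ 0 := by rintro rfl; apply hww; rw [← hy]; simp
      have hσy0 : σ y ≠ 0 := (map_ne_zero σ).2 hy0
      have e1 : ∀ i, h (v i) (y⁻¹ • w) = 0 := fun i => by
        rw [hsmul, (hW w).1 hw i, mul_zero]
      have e2 : h (y⁻¹ • w) (y⁻¹ • w) = 1 := by
        rw [hsmul, ← hconj, hsmul, map_mul, hconj, ← hy, map_inv₀]
        field_simp
      refine ⟨Fin.cons (y⁻¹ • w) v, fun i j => ?_⟩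
      refine Fin.cases ?_ (fun i => ?_) i <;> refine Fin.cases ?_ (fun j => ?_) j
      · simpa using e2
      · have := e1 j
        rw [← hconj, map_eq_zero] at this
        rw [Fin.cons_zero, Fin.cons_succ, this, if_neg (Fin.succ_ne_zero j).symm]
      · rw [Fin.cons_zero, Fin.cons_succ, e1, if_neg (Fin.succ_ne_zero i)]
      · simp only [Fin.cons_succ, hv, Fin.succ_inj]
  obtain ⟨v, hv⟩ := main n le_rfl
  refine ⟨Matrix.of fun a j => v j a, ?_⟩
  ext i j
  rw [one_apply, ← hv, Matrix.mul_assoc]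
  rfl

theorem hcr_norm (q : ℕ) (hq : 2 ≤ q) (K : Type) [Field K] [Fintype K]
    (hK : Fintype.card K = q ^ 2) (c : K) (hc : c ^ q = c) (h0 : c ≠ 0) :
    ∃ y : K, y ^ q * y = c := by
  classical
  obtain ⟨g, hg⟩ := IsCyclic.exists_generator (α := Kˣ)
  obtain ⟨j, hj⟩ := (Submonoid.mem_powers_iff _ _).1 (mem_powers_iff_mem_zpowers.2 (hg (Units.mk0 c h0)))
  have ho : orderOf g = (q - 1) * (q + 1) := by
    rw [orderOf_eq_card_of_forall_mem_zpowers hg, Nat.card_eq_fintype_card, Fintype.card_units, hK]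
    obtain ⟨r, rfl⟩ : ∃ r, q = r + 1 := ⟨q - 1, by omega⟩
    have : (r + 1) ^ 2 = r * (r + 1 + 1) + 1 := by ring
    rw [this]; rfl
  have hc1 : (Units.mk0 c h0) ^ (q - 1) = 1 := by
    ext
    have : c ^ (q - 1) * c = 1 * c := by rw [← pow_succ, Nat.sub_add_cancel (by omega), hc, one_mul]
    simpa using mul_right_cancel₀ h0 this
  rw [← hj, ← pow_mul] at hc1
  have hd := orderOf_dvd_of_pow_eq_one hc1
  rw [ho, mul_comm j] at hd
  obtain ⟨t, rfl⟩ := Nat.dvd_of_mul_dvd_mul_left (by omega) hd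
  refine ⟨(g : K) ^ t, ?_⟩
  have := congrArg Units.val hj
  simp only [Units.val_pow_eq_pow_val, Units.val_mk0] at this
  rw [← this, ← pow_succ, ← pow_mul]; congr 1; ring

theorem hcr_nonfix (q : ℕ) (hq : 2 ≤ q) (K : Type) [Field K] [Fintype K]
    (hK : Fintype.card K = q ^ 2) : ∃ α : K, α ^ q ≠ α := by
  classical
  by_contra hcon
  push Not at hcon
  have h1 : (Polynomial.X ^ q - Polynomial.X : Polynomial K) ≠ 0 :=
    FiniteField.X_pow_card_sub_X_ne_zero K (by omega)
  have h2 := Polynomial.card_le_degree_of_subset_roots (p := (Polynomial.X ^ q - Polynomial.X : Polynomial K)) (Z := Finset.univ)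
    (by intro x _; rw [Polynomial.mem_roots h1]; simp [hcon])
  rw [Finset.card_univ, hK, FiniteField.X_pow_card_sub_X_natDegree_eq K (by omega)] at h2
  nlinarith

theorem hcr_frob (q : ℕ) (hq : ∃ p m : ℕ, p.Prime ∧ 0 < m ∧ q = p ^ m)
    (K : Type) [Field K] [Fintype K] (hK : Fintype.card K = q ^ 2) :
    ∃ σ : K →+* K, ∀ x, σ x = x ^ q := by
  obtain ⟨p, m, hp, hm, rfl⟩ := hq
  have := Fact.mk hp
  obtain ⟨r, hr⟩ := CharP.exists K
  obtain ⟨s, hs, hs2⟩ := FiniteField.card K r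
  have : r = p := by
    rw [hK, ← pow_mul] at hs2
    have : r ∣ p ^ (m * 2) := hs2 ▸ dvd_pow_self r s.pos.ne'
    exact (Nat.prime_dvd_prime_iff_eq hs hp).1 (hs.dvd_of_dvd_pow this)
  subst this
  exact ⟨iterateFrobenius K r m, fun x => iterateFrobenius_def r m x⟩

theorem hcr_invol {ι X : Type} [Fintype ι] (g : ι → X) (s : X → X) (hs : ∀ x, s (s x) = x)
    (hc : ∀ x, Nat.card {i // g i = x} = Nat.card {i // g i = s x}) :
    ∃ τ : ι → ι, (∀ i, τ (τ i) = i) ∧ ∀ i, g (τ i) = s (g i) := by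
  classical
  have he : ∀ x, Nonempty ({i // g i = x} ≃ {i // g i = s x}) := fun x =>
    ⟨Classical.choice (Finite.card_eq.1 (hc x))⟩
  let e : ∀ x, {i // g i = x} ≃ {i // g i = s x} := fun x => (he x).some
  let _ : LinearOrder X := linearOrderOfSTO WellOrderingRel
  let τ : ι → ι := fun i => if g i = s (g i) then i else if g i < s (g i) then (e (g i) ⟨i, rfl⟩).1
    else ((e (s (g i))).symm ⟨i, (hs _).symm⟩).1
  have hE : ∀ x y (h : x = y) i (hi : g i = x) (hi' : g i = y), (e x ⟨i, hi⟩).1 = (e y ⟨i, hi'⟩).1 := by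
    intro x y h; subst h; intros; rfl
  have hE2 : ∀ x y (h : x = y) i (hi : g i = s x) (hi' : g i = s y),
      ((e x).symm ⟨i, hi⟩).1 = ((e y).symm ⟨i, hi'⟩).1 := by
    intro x y h; subst h; intros; rfl
  have hg : ∀ i, g (τ i) = s (g i) := by
    intro i
    simp only [τ]
    split_ifs with h1 h2
    · exact h1
    · exact (e (g i) ⟨i, rfl⟩).2
    · exact ((e (s (g i))).symm ⟨i, (hs _).symm⟩).2
  refine ⟨τ, fun i => ?_, hg⟩
  by_cases h1 : g i = s (g i)
  · have : τ i = i := if_pos h1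
    rw [this, this]
  have h1' : ¬ g (τ i) = s (g (τ i)) := by rw [hg, hs]; exact fun h => h1 h.symm
  by_cases h2 : g i < s (g i)
  · have ht : τ i = (e (g i) ⟨i, rfl⟩).1 := by simp only [τ]; rw [if_neg h1, if_pos h2]
    have h2' : ¬ g (τ i) < s (g (τ i)) := by rw [hg, hs]; exact h2.asymm
    have ht2 : τ (τ i) = ((e (s (g (τ i)))).symm ⟨τ i, (hs _).symm⟩).1 := by
      conv_lhs => unfold τ
      rw [if_neg h1', if_neg h2']
    rw [ht2, hE2 _ (g i) (by rw [hg, hs]) _ _ (hg i)]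
    have : (⟨τ i, hg i⟩ : {j // g j = s (g i)}) = e (g i) ⟨i, rfl⟩ := Subtype.ext ht
    rw [this, Equiv.symm_apply_apply]
  · have ht : τ i = ((e (s (g i))).symm ⟨i, (hs _).symm⟩).1 := by
      simp only [τ]; rw [if_neg h1, if_neg h2]
    have h2' : g (τ i) < s (g (τ i)) := by
      rw [hg, hs]; exact lt_of_le_of_ne (not_lt.1 h2) (fun h => h1 h.symm)
    have ht2 : τ (τ i) = (e (g (τ i)) ⟨τ i, rfl⟩).1 := by
      conv_lhs => unfold τ
      rw [if_neg h1', if_pos h2']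
    rw [ht2, hE _ (s (g i)) (hg i) _ _ (hg i)]
    have : (⟨τ i, hg i⟩ : {j // g j = s (g i)}) = (e (s (g i))).symm ⟨i, (hs _).symm⟩ :=
      Subtype.ext ht
    rw [this, Equiv.apply_symm_apply]

theorem hcr_descent {K : Type} [Field K] (σ : K →+* K) (hσ : ∀ x, σ (σ x) = x)
    (α : K) (hα : σ α ≠ α) {n : ℕ} (A : Matrix (Fin n) (Fin n) K)
    (T : (Fin n → K) →+ (Fin n → K)) (hT : ∀ v, T (T v) = v)
    (hTs : ∀ (c : K) v, T (c • v) = σ c • T v) (hTA : ∀ v, T (A *ᵥ v) = A *ᵥ T v) :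
    ∃ V : Matrix (Fin n) (Fin n) K, IsUnit V ∧
      ∀ i j, σ ((V⁻¹ * A * V) i j) = (V⁻¹ * A * V) i j := by
  classical
  let s : Set (Fin n → K) := {v | T v = v}
  have hspan : ⊤ ≤ Submodule.span K s := by
    intro v _
    have h1 : v + T v ∈ s := by
      change T (v + T v) = _
      rw [map_add, hT, add_comm]
    have h2 : α • v + σ α • T v ∈ s := by
      change T (α • v + σ α • T v) = _
      rw [map_add, hTs, hTs, hT, hσ, add_comm]
    have h0 : α - σ α ≠ 0 := fun h => hα (sub_eq_zero.1 h).symm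
    have : v = (α - σ α)⁻¹ • ((α • v + σ α • T v) - σ α • (v + T v)) := by
      rw [eq_inv_smul_iff₀ h0]; module
    rw [this]
    exact Submodule.smul_mem _ _ (Submodule.sub_mem _ (Submodule.subset_span h2)
      (Submodule.smul_mem _ _ (Submodule.subset_span h1)))
  let b0 := Module.Basis.ofSpan hspan
  have hb0 : ∀ i, T (b0 i) = b0 i := fun i => Module.Basis.ofSpan_subset hspan ⟨i, rfl⟩
  have := Module.Finite.finite_basis b0
  have := Fintype.ofFinite ((linearIndepOn_empty K id).extend
    (Set.empty_subset s))
  have hcard := Module.finrank_eq_nat_card_basis b0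
  rw [Module.finrank_fin_fun] at hcard
  let eq := Finite.equivFinOfCardEq hcard.symm
  let b := b0.reindex eq
  have hb : ∀ j, T (b j) = b j := fun j => by simp only [b, Module.Basis.reindex_apply, hb0]
  let V : Matrix (Fin n) (Fin n) K := Matrix.of fun a j => b j a
  have hV : IsUnit V := by
    rw [← Matrix.mulVec_injective_iff_isUnit, Matrix.mulVec_injective_iff]
    exact b.linearIndependent
  have hdet := (Matrix.isUnit_iff_isUnit_det _).1 hV
  refine ⟨V, hV, ?_⟩
  set C := V⁻¹ * A * V with hC
  have hVC : V * C = A * V := by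
    rw [hC, ← Matrix.mul_assoc, ← Matrix.mul_assoc, Matrix.mul_nonsing_inv _ hdet, Matrix.one_mul]
  have hcol : ∀ j, A *ᵥ b j = ∑ l, C l j • b l := by
    intro j
    ext a
    have := congrFun (congrFun hVC a) j
    simp only [Matrix.mul_apply, V, of_apply] at this
    simp only [mulVec, dotProduct, Finset.sum_apply, Pi.smul_apply, smul_eq_mul]
    rw [← this]
    exact Finset.sum_congr rfl fun _ _ => mul_comm _ _
  intro l j
  have h1 := congrArg T (hcol j)
  rw [hTA, hb, hcol, map_sum] at h1
  simp only [hTs, hb] at h1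
  have h2 := congrArg (fun v => b.repr v l) h1
  simpa [Finsupp.single_apply] using h2.symm

open Polynomial in
theorem hcr_cyc {k : Type} [Field k] (g f d : k[X]) (h : ∀ x, g ∣ f * x ↔ d ∣ x) :
    Module.finrank k (LinearMap.range (LinearMap.mulLeft k (AdjoinRoot.mk g f))) = d.natDegree := by
  let L : k[X] →ₗ[k] AdjoinRoot g :=
    (LinearMap.mulLeft k (AdjoinRoot.mk g f)).comp (AdjoinRoot.mkₐ g).toLinearMap
  have hr : LinearMap.range L = LinearMap.range (LinearMap.mulLeft k (AdjoinRoot.mk g f)) := by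
    apply LinearMap.range_comp_of_range_eq_top
    rw [LinearMap.range_eq_top]
    exact AdjoinRoot.mk_surjective
  have hk : LinearMap.ker L = (Ideal.span {d}).restrictScalars k := by
    ext x
    rw [LinearMap.mem_ker, Submodule.restrictScalars_mem, Ideal.mem_span_singleton, ← h]
    change AdjoinRoot.mk g f * AdjoinRoot.mk g x = 0 ↔ _
    rw [← map_mul, AdjoinRoot.mk_eq_zero]
  rw [← hr, ← L.quotKerEquivRange.finrank_eq, hk]
  rw [← finrank_quotient_span_eq_natDegree]
  exact (Submodule.Quotient.restrictScalarsEquiv k (Ideal.span {d})).finrank_eq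

open Polynomial in
theorem hcr_rank_sum {k : Type} [Field k] {n : ℕ} (M : Matrix (Fin n) (Fin n) k)
    {ι : Type} [Fintype ι] (g : ι → k[X]) (hg : ∀ i, (g i).Monic) (f : k[X])
    (Φ : (Fin n → k) ≃ₗ[k] (∀ i, AdjoinRoot (g i)))
    (hΦ : ∀ v i, Φ (M *ᵥ v) i = AdjoinRoot.mk _ f * Φ v i) :
    M.rank = ∑ i, Module.finrank k
      (LinearMap.range (LinearMap.mulLeft k (AdjoinRoot.mk (g i) f))) := by
  classical
  have : ∀ i, Module.Finite k (AdjoinRoot (g i)) := fun i => (hg i).finite_adjoinRoot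
  rw [← Module.finrank_pi_fintype]
  let J : (∀ i, LinearMap.range (LinearMap.mulLeft k (AdjoinRoot.mk (g i) f))) →ₗ[k] (Fin n → k) :=
    Φ.symm.toLinearMap.comp (LinearMap.pi fun i => (Submodule.subtype _).comp (LinearMap.proj i))
  have hJ : ∀ x i, Φ (J x) i = (x i : AdjoinRoot (g i)) := fun x i => by simp [J]
  have hinj : Function.Injective J := by
    intro x y hxy
    funext i
    apply Subtype.ext
    rw [← hJ, ← hJ, hxy]
  rw [← LinearMap.finrank_range_of_inj hinj, Matrix.rank]
  have : LinearMap.range M.mulVecLin = LinearMap.range J := by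
    ext v
    constructor
    · rintro ⟨w, rfl⟩
      refine ⟨fun i => ⟨AdjoinRoot.mk _ f * Φ w i, ⟨Φ w i, rfl⟩⟩, ?_⟩
      apply Φ.injective
      funext i
      rw [hJ, Matrix.mulVecLin_apply, hΦ]
    · rintro ⟨x, rfl⟩
      choose y hy using fun i => (x i).2
      refine ⟨Φ.symm y, ?_⟩
      apply Φ.injective
      funext i
      rw [hJ, Matrix.mulVecLin_apply, hΦ, LinearEquiv.apply_symm_apply]
      exact hy i
  rw [this]

open Polynomial in
theorem hcr_rank_pow {k : Type} [Field k] {n : ℕ} (A : Matrix (Fin n) (Fin n) k)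
    {ι : Type} [Fintype ι] [DecidableEq k[X]] (p : ι → k[X]) (e : ι → ℕ)
    (hp : ∀ i, Irreducible (p i)) (hm : ∀ i, (p i).Monic)
    (Φ : (Fin n → k) ≃ₗ[k] (∀ i, AdjoinRoot (p i ^ e i)))
    (hΦ : ∀ (f : k[X]) v i, Φ ((aeval A f) *ᵥ v) i = AdjoinRoot.mk _ f * Φ v i)
    (r : k[X]) (hr : Irreducible r) (hrm : r.Monic) (j : ℕ) :
    (aeval A (r ^ j)).rank = ∑ i, if p i = r then (e i - j) * r.natDegree
      else e i * (p i).natDegree := by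
  rw [hcr_rank_sum _ (fun i => p i ^ e i) (fun i => (hm i).pow _) (r ^ j) Φ (hΦ _)]
  refine Finset.sum_congr rfl fun i _ => ?_
  split_ifs with h
  · subst h
    rw [hcr_cyc _ _ (p i ^ (e i - j)), natDegree_pow]
    intro x
    rcases le_total j (e i) with h | h
    · conv_lhs => rw [← Nat.add_sub_cancel' h, pow_add]
      exact mul_dvd_mul_iff_left (pow_ne_zero _ (hp i).ne_zero)
    · rw [Nat.sub_eq_zero_of_le h]
      simp only [pow_zero, isUnit_one, IsUnit.dvd, iff_true]
      exact (pow_dvd_pow _ h).mul_right _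
  · rw [hcr_cyc _ _ (p i ^ e i), natDegree_pow]
    intro x
    have hco : IsCoprime (p i) r := by
      rw [(hp i).coprime_iff_not_dvd]
      intro hd
      exact h (eq_of_monic_of_associated (hm i) hrm ((hp i).associated_of_dvd hr hd))
    have hco2 : IsCoprime (p i ^ e i) (r ^ j) := hco.pow
    exact ⟨fun hd => hco2.dvd_of_dvd_mul_left hd, fun hd => hd.mul_left _⟩

open Polynomial in
theorem hcr_count {k : Type} [Field k] {n : ℕ} (A : Matrix (Fin n) (Fin n) k)
    {ι : Type} [Fintype ι] [DecidableEq k[X]] (p : ι → k[X]) (e : ι → ℕ)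
    (hp : ∀ i, Irreducible (p i)) (hm : ∀ i, (p i).Monic)
    (Φ : (Fin n → k) ≃ₗ[k] (∀ i, AdjoinRoot (p i ^ e i)))
    (hΦ : ∀ (f : k[X]) v i, Φ ((aeval A f) *ᵥ v) i = AdjoinRoot.mk _ f * Φ v i)
    (r : k[X]) (hr : Irreducible r) (hrm : r.Monic) (j : ℕ) :
    (aeval A (r ^ j)).rank + (aeval A (r ^ (j + 2))).rank = 2 * (aeval A (r ^ (j + 1))).rank +
      r.natDegree * Nat.card {i // p i ^ e i = r ^ (j + 1)} := by
  classical
  have hiff : ∀ i, p i ^ e i = r ^ (j + 1) ↔ p i = r ∧ e i = j + 1 := by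
    intro i
    constructor
    · intro h
      have hd : r ∣ p i ^ e i := h ▸ dvd_pow_self r (by omega)
      have hpr : p i = r := (eq_of_monic_of_associated hrm (hm i)
        (hr.associated_of_dvd (hp i) (hr.prime.dvd_of_dvd_pow hd))).symm
      refine ⟨hpr, ?_⟩
      rw [hpr] at h
      have := congrArg natDegree h
      rw [natDegree_pow, natDegree_pow] at this
      exact Nat.eq_of_mul_eq_mul_right hr.natDegree_pos this
    · rintro ⟨h1, h2⟩; rw [h1, h2]
  rw [Nat.card_eq_fintype_card, Fintype.card_subtype, Finset.card_filter]
  simp only [hcr_rank_pow A p e hp hm Φ hΦ r hr hrm, Finset.mul_sum, ← Finset.sum_add_distrib]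
  refine Finset.sum_congr rfl fun i _ => ?_
  simp only [hiff]
  by_cases h : p i = r
  · simp only [h, if_true, true_and]
    split_ifs with h2
    · rw [h2]
      simp
    · rw [← add_mul, mul_zero, add_zero, ← mul_assoc]
      congr 1
      omega
  · simp [h]; ring

theorem hcr_rank_map {K : Type} [Field K] (σ : K →+* K) (hσ : ∀ x, σ (σ x) = x)
    {n : ℕ} (M : Matrix (Fin n) (Fin n) K) : (M.map σ).rank = M.rank := by
  have hle : ∀ M : Matrix (Fin n) (Fin n) K, M.rank ≤ (M.map σ).rank := by
    intro M
    have h1 : ∀ v, σ ∘ (M *ᵥ v) = (M.map σ) *ᵥ (σ ∘ v) := by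
      intro v; ext i; exact RingHom.map_mulVec σ M v i
    have h2 : ∀ v, σ ∘ ((M.map σ) *ᵥ v) = M *ᵥ (σ ∘ v) := by
      intro v; ext i
      rw [Function.comp_apply, RingHom.map_mulVec σ]
      congr 2
      ext a b; simp [hσ]
    have hh : ∀ v : Fin n → K, σ ∘ σ ∘ v = v := fun v => by ext i; simp [hσ]
    let e : LinearMap.range M.mulVecLin ≃+ LinearMap.range (M.map σ).mulVecLin :=
      { toFun := fun x => ⟨σ ∘ x.1, by
          obtain ⟨w, hw⟩ := x.2
          exact ⟨σ ∘ w, by rw [← hw]; simp [h1]⟩⟩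
        invFun := fun x => ⟨σ ∘ x.1, by
          obtain ⟨w, hw⟩ := x.2
          exact ⟨σ ∘ w, by rw [← hw]; simp [h2]⟩⟩
        left_inv := fun x => Subtype.ext (hh _)
        right_inv := fun x => Subtype.ext (hh _)
        map_add' := fun x y => by
          apply Subtype.ext; ext i; simp }
    have hb : Function.Bijective σ := ⟨σ.injective, fun x => ⟨σ x, hσ x⟩⟩
    have := rank_eq_of_equiv_equiv (R := K) (R' := K) (M := LinearMap.range M.mulVecLin)
      (M₁ := LinearMap.range (M.map σ).mulVecLin) σ e hb (by
        intro r m; apply Subtype.ext; ext i; simp [e])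
    exact (congrArg Cardinal.toNat this).le
  refine le_antisymm ?_ (hle M)
  have := hle (M.map σ)
  rwa [Matrix.map_map, show (σ ∘ σ : K → K) = id from funext hσ, Matrix.map_id] at this

open Polynomial in
theorem hcr_aeval_conj {K : Type} [Field K] (σ : K →+* K)
    {n : ℕ} (A : Matrix (Fin n) (Fin n) K) (hA : (A.map σ)ᵀ = A) (f : K[X]) :
    aeval A (f.map σ) = ((aeval A f).map σ)ᵀ := by
  induction f using Polynomial.induction_on' with
  | add f g hf hg =>
    rw [Polynomial.map_add, map_add, hf, hg, map_add, Matrix.map_add _ (map_add σ), transpose_add]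
  | monomial m c =>
    rw [Polynomial.map_monomial, aeval_monomial, aeval_monomial, ← Algebra.smul_def,
      ← Algebra.smul_def]
    have h1 : (c • A ^ m).map σ = σ c • (A.map σ) ^ m := by
      have : (A.map σ) ^ m = (A ^ m).map σ := (map_pow σ.mapMatrix A m).symm
      rw [this]
      ext i j; simp
    rw [h1, transpose_smul, transpose_pow, hA]

open Polynomial in
theorem hcr_adjmap_mk {K : Type} [Field K] (σ : K →+* K) (g g' : K[X]) (h : g' ∣ g.map σ)
    (f : K[X]) : AdjoinRoot.map σ g g' h (AdjoinRoot.mk g f) = AdjoinRoot.mk g' (f.map σ) := by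
  induction f using Polynomial.induction_on with
  | C a => simp
  | add p q hp hq => simp only [map_add, Polynomial.map_add, hp, hq]
  | monomial n a h => simp

open Polynomial in
theorem hcr_fwd {K : Type} [Field K] (σ : K →+* K) (hσ : ∀ x, σ (σ x) = x)
    (α : K) (hα : σ α ≠ α) {n : ℕ} (A : Matrix (Fin n) (Fin n) K) (hA : (A.map σ)ᵀ = A) :
    ∃ V : Matrix (Fin n) (Fin n) K, IsUnit V ∧
      ∀ i j, σ ((V⁻¹ * A * V) i j) = (V⁻¹ * A * V) i j := by
  classical
  obtain ⟨ι, _, p, e, hp, hm, Φ, hΦ⟩ := hcr_struct A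
  have hss : ∀ f : K[X], (f.map σ).map σ = f := fun f => by ext; simp [hσ]
  have hrank : ∀ f : K[X], (aeval A (f.map σ)).rank = (aeval A f).rank := fun f => by
    rw [hcr_aeval_conj σ A hA, rank_transpose, hcr_rank_map σ hσ]
  have hirr : ∀ f : K[X], Irreducible f → Irreducible (f.map σ) := by
    intro f hf
    let E : K ≃+* K := RingEquiv.ofRingHom σ σ (RingHom.ext hσ) (RingHom.ext hσ)
    exact (MulEquiv.irreducible_iff (Polynomial.mapEquiv E).toMulEquiv).2 hf
  have hcpow : ∀ (i : ι), Nat.card {l // p l ^ e l = p i ^ e i} =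
      Nat.card {l // p l ^ e l = (p i ^ e i).map σ} := by
    intro i
    rcases hj : e i with _ | j
    · simp
    have h1 := hcr_count A p e hp hm Φ hΦ (p i) (hp i) (hm i) j
    have h2 := hcr_count A p e hp hm Φ hΦ ((p i).map σ) (hirr _ (hp i)) ((hm i).map σ) j
    simp only [← Polynomial.map_pow, hrank, natDegree_map] at h2
    have h3 : (p i).natDegree * Nat.card {l // p l ^ e l = p i ^ (j + 1)} =
      (p i).natDegree * Nat.card {l // p l ^ e l = (p i ^ (j + 1)).map σ} := by omega
    exact Nat.eq_of_mul_eq_mul_left (hp i).natDegree_pos h3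
  have hcard : ∀ x : K[X], Nat.card {l // p l ^ e l = x} = Nat.card {l // p l ^ e l = x.map σ} := by
    intro x
    by_cases h1 : ∃ i, p i ^ e i = x
    · obtain ⟨i, rfl⟩ := h1
      exact hcpow i
    by_cases h2 : ∃ i, p i ^ e i = x.map σ
    · obtain ⟨i, hi⟩ := h2
      have := hcpow i
      rw [hi, hss] at this
      exact this.symm
    push Not at h1 h2
    have i1 : IsEmpty {l // p l ^ e l = x} := ⟨fun l => h1 l.1 l.2⟩
    have i2 : IsEmpty {l // p l ^ e l = x.map σ} := ⟨fun l => h2 l.1 l.2⟩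
    rw [Nat.card_of_isEmpty, Nat.card_of_isEmpty]
  obtain ⟨τ, hττ, hτ⟩ := hcr_invol (fun i => p i ^ e i) (fun f => f.map σ) hss hcard
  have hd : ∀ i, p i ^ e i ∣ (p (τ i) ^ e (τ i)).map σ := fun i => by
    have := hτ i
    rw [this, hss]
  let c : ∀ i, AdjoinRoot (p (τ i) ^ e (τ i)) →+* AdjoinRoot (p i ^ e i) := fun i =>
    AdjoinRoot.map σ _ _ (hd i)
  have hcc : ∀ i j l (h1 : p i ^ e i ∣ (p j ^ e j).map σ) (h2 : p j ^ e j ∣ (p l ^ e l).map σ)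
      (_ : l = i) (x : ∀ i, AdjoinRoot (p i ^ e i)),
      AdjoinRoot.map σ _ _ h1 (AdjoinRoot.map σ _ _ h2 (x l)) = x i := by
    intro i j l h1 h2 hl x
    subst hl
    obtain ⟨f, hf⟩ := AdjoinRoot.mk_surjective (x l)
    rw [← hf, hcr_adjmap_mk, hcr_adjmap_mk, hss]
  let T : (Fin n → K) →+ (Fin n → K) :=
    { toFun := fun v => Φ.symm fun i => c i (Φ v (τ i))
      map_zero' := by
        rw [LinearEquiv.symm_apply_eq]; funext i; simp
      map_add' := fun v w => by
        rw [← map_add]; congr 1; funext i; simp }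
  have hTΦ : ∀ v i, Φ (T v) i = c i (Φ v (τ i)) := fun v i => by simp [T]
  have hTf : ∀ (f : K[X]) v, T ((aeval A f) *ᵥ v) = (aeval A (f.map σ)) *ᵥ T v := by
    intro f v
    apply Φ.injective
    funext i
    rw [hTΦ, hΦ, hΦ, hTΦ, map_mul, hcr_adjmap_mk]
  refine hcr_descent σ hσ α hα A T ?_ ?_ ?_
  · intro v
    apply Φ.injective
    funext i
    rw [hTΦ, hTΦ]
    exact hcc i (τ i) (τ (τ i)) _ _ (hττ i) (Φ v)
  · intro a v
    have := hTf (C a) v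
    rwa [Polynomial.map_C, aeval_C, aeval_C, Algebra.algebraMap_eq_smul_one,
      Algebra.algebraMap_eq_smul_one, smul_mulVec, smul_mulVec, one_mulVec, one_mulVec] at this
  · intro v
    have := hTf X v
    rwa [Polynomial.map_X, aeval_X] at this

theorem hcr_bwd {K : Type} [Field K] (σ : K →+* K) (hσ : ∀ x, σ (σ x) = x)
    (α : K) (hα : σ α ≠ α) (hN : ∀ c, σ c = c → c ≠ 0 → ∃ y, σ y * y = c)
    {n : ℕ} (A : Matrix (Fin n) (Fin n) K) (hA : A.map σ = A) :
    ∃ V : Matrix (Fin n) (Fin n) K, IsUnit V ∧ ((V⁻¹ * A * V).map σ)ᵀ = V⁻¹ * A * V := by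
  classical
  let k : Subfield K := RingHom.eqLocusField σ (RingHom.id K)
  have hk : ∀ x : k, σ x = x := fun x => x.2
  let A0 : Matrix (Fin n) (Fin n) k := Matrix.of fun i j => ⟨A i j, congrFun (congrFun hA i) j⟩
  have hA0 : A0.map k.subtype = A := rfl
  obtain ⟨S0, hS0, hsym, hSA⟩ := hcr_symm A0
  let S := S0.map k.subtype
  have hS : IsUnit S := hS0.map k.subtype.mapMatrix
  have hSσ : S.map σ = S := by ext i j; exact hk _
  have hST : Sᵀ = S := by
    change (S0.map k.subtype)ᵀ = _
    rw [← transpose_map, hsym]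
  have hSA' : S * A = Aᵀ * S := by
    have := congrArg (fun M => M.map k.subtype) hSA
    simp only [Matrix.map_mul, transpose_map, hA0] at this
    exact this
  obtain ⟨V, hV⟩ := hcr_onb σ hσ α hα hN S hS (by rw [hSσ, hST])
  have hVu : IsUnit V := IsUnit.of_mul_eq_one_right _ hV
  have hdet := (Matrix.isUnit_iff_isUnit_det _).1 hVu
  have hSdet := (Matrix.isUnit_iff_isUnit_det _).1 hS
  refine ⟨V, hVu, ?_⟩
  have hVinv : V⁻¹ = (V.map σ)ᵀ * S := Matrix.inv_eq_left_inv hV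
  have hSm : S⁻¹ * S = 1 := Matrix.nonsing_inv_mul _ hSdet
  rw [hVinv]
  simp only [Matrix.map_mul, transpose_mul]
  rw [hSσ, hST, hA]
  have : ((V.map σ)ᵀ.map σ)ᵀ = V := by ext i j; simp [hσ]
  rw [this]
  simp only [Matrix.mul_assoc]
  rw [← Matrix.mul_assoc S A V, hSA', Matrix.mul_assoc]

theorem hermitian_conjugate_iff_rational
    (q : ℕ) (hq : ∃ p m : ℕ, p.Prime ∧ 0 < m ∧ q = p ^ m)
    (K : Type) [Field K] [Fintype K] (hK : Fintype.card K = q ^ 2)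
    (n : ℕ) (hn : 1 ≤ n) (A : Matrix (Fin n) (Fin n) K) :
    (∃ P : Matrix (Fin n) (Fin n) K, IsUnit P ∧
      ((P * A * P⁻¹).map (fun a => a ^ q))ᵀ = P * A * P⁻¹) ↔
    (∃ P : Matrix (Fin n) (Fin n) K, IsUnit P ∧
      ∀ i j, ((P * A * P⁻¹) i j) ^ q = (P * A * P⁻¹) i j) := by
  have hq2 : 2 ≤ q := by
    obtain ⟨p, m, hp, hm, rfl⟩ := hq
    exact hp.two_le.trans (Nat.le_self_pow hm.ne' p)
  obtain ⟨σ, hs⟩ := hcr_frob q hq K hK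
  have hσ : ∀ x, σ (σ x) = x := fun x => by
    rw [hs, hs, ← pow_mul, ← sq, ← hK, FiniteField.pow_card]
  obtain ⟨α, hα'⟩ := hcr_nonfix q hq2 K hK
  have hα : σ α ≠ α := by rwa [hs]
  have hN : ∀ c, σ c = c → c ≠ 0 → ∃ y, σ y * y = c := by
    intro c hc h0
    obtain ⟨y, hy⟩ := hcr_norm q hq2 K hK c (by rwa [← hs]) h0
    exact ⟨y, by rwa [hs]⟩
  have hfun : (fun a : K => a ^ q) = σ := funext fun a => (hs a).symm
  have hcomb : ∀ P V : Matrix (Fin n) (Fin n) K, IsUnit V →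
      (V⁻¹ * P) * A * (V⁻¹ * P)⁻¹ = V⁻¹ * (P * A * P⁻¹) * V := by
    intro P V hV
    rw [Matrix.mul_inv_rev, Matrix.nonsing_inv_nonsing_inv _ ((Matrix.isUnit_iff_isUnit_det _).1 hV)]
    simp only [Matrix.mul_assoc]
  rw [hfun]
  constructor
  · rintro ⟨P, hP, h⟩
    obtain ⟨V, hV, hVA⟩ := hcr_fwd σ hσ α hα _ h
    refine ⟨V⁻¹ * P, (Matrix.isUnit_nonsing_inv_iff.2 hV).mul hP, ?_⟩
    rw [hcomb P V hV]
    intro i j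
    rw [← hs, hVA]
  · rintro ⟨P, hP, h⟩
    obtain ⟨V, hV, hVA⟩ := hcr_bwd σ hσ α hα hN (P * A * P⁻¹) (by ext i j; simp only [map_apply, hs, h])
    refine ⟨V⁻¹ * P, (Matrix.isUnit_nonsing_inv_iff.2 hV).mul hP, ?_⟩
    rw [hcomb P V hV, hVA]
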